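/- arXiv:1601.00013 — 2 statements merged into one kernel-verified Lean document; each statement's English description precedes it below -/
import Mathlib

section
/- For any positive real numbers α and λ, there exists an infinitely differentiable function σ : ℝ → ℝ such that: (i) σ(t) → 0 as t → −∞ and σ(t) → 1 as t → +∞; (ii) σ is strictly increasing on (−∞, α); (iii) σ is λ-strictly increasing on [α, +∞); and (iv) for every finite closed interval [a, b] with a < b, every continuous function f : [a, b] → ℝ, and every ε > 0, there exist real numbers c₀, c₁ and θ such that |f(t) − c₁·σ((α/(b−a))·t − θ) − c₀| < ε for all t ∈ [a, b]. -/
open Polynomial in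
lemma poly_seq : ∃ q : ℕ → ℝ[X], ∀ f : ℝ → ℝ, ContinuousOn f (Set.Icc 0 1) → ∀ ε : ℝ, 0 < ε →
    ∃ n, ∀ t ∈ Set.Icc (0:ℝ) 1, |f t - (q n).eval t| < ε := by
  let T : ℝ[X] → C(Set.Icc (0:ℝ) 1, ℝ) := fun p => p.toContinuousMapOn (Set.Icc (0:ℝ) 1)
  have : Nonempty (Set.range T) := ⟨⟨T 0, 0, rfl⟩⟩
  have hsep : TopologicalSpace.SeparableSpace (Set.range T) := inferInstance
  let d : ℕ → Set.range T := TopologicalSpace.denseSeq (Set.range T)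
  have hd : DenseRange d := TopologicalSpace.denseRange_denseSeq _
  choose q hq using fun n => (d n).2
  refine ⟨q, fun f hf ε hε => ?_⟩
  obtain ⟨p, hp⟩ := exists_polynomial_near_of_continuousOn 0 1 f hf (ε/2) (by linarith)
  obtain ⟨n, hn⟩ := hd.exists_dist_lt (⟨T p, p, rfl⟩ : Set.range T) (half_pos hε)
  refine ⟨n, fun t ht => ?_⟩
  have h1 : dist (T p ⟨t, ht⟩) ((d n : C(Set.Icc (0:ℝ) 1, ℝ)) ⟨t, ht⟩) < ε / 2 :=
    lt_of_le_of_lt (ContinuousMap.dist_apply_le_dist _) hn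
  rw [← hq n] at h1
  have h2 := hp t ht
  simp only [T, Polynomial.toContinuousMapOn_apply, Polynomial.toContinuousMap_apply,
    Real.dist_eq] at h1
  rw [abs_lt] at *
  constructor <;> linarith [h1.1, h1.2, h2.1, h2.2]

/-- a smooth function agreeing up to scaling with a dense sequence on successive intervals -/
lemma bump_sum (c : ℝ) (hc : 0 < c) : ∃ P : ℝ → ℝ, ContDiff ℝ (⊤ : ℕ∞) P ∧
    (∀ y ≤ 1, P y = 0) ∧ (∀ y, |P y| ≤ c) ∧ Filter.Tendsto P Filter.atTop (nhds 0) ∧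
    ∀ f : ℝ → ℝ, ContinuousOn f (Set.Icc 0 1) → ∀ ε : ℝ, 0 < ε →
      ∃ (n : ℕ) (k : ℝ), ∀ t ∈ Set.Icc (0:ℝ) 1, |f t - k * P (t + (2 * n + 2))| < ε := by
  obtain ⟨q, hq⟩ := poly_seq
  let ψ : ContDiffBump (1/2 : ℝ) := ⟨1/2, 3/4, by norm_num, by norm_num⟩
  have hψ1 : ∀ t ∈ Set.Icc (0:ℝ) 1, ψ t = 1 := fun t ht => by
    apply ψ.one_of_mem_closedBall
    rw [Metric.mem_closedBall, Real.dist_eq, abs_le]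
    constructor <;> linarith [ht.1, ht.2]
  have hψ0 : ∀ t, ψ t ≠ 0 → -1/4 < t ∧ t < 5/4 := fun t ht => by
    have : t ∈ Function.support ψ := ht
    rw [ψ.support_eq, Metric.mem_ball, Real.dist_eq, abs_lt] at this
    change -(3/4) < t - 1/2 ∧ t - 1/2 < 3/4 at this
    constructor <;> linarith [this.1, this.2]
  have hM : ∀ n, ∃ M, ∀ t, ‖ψ t * (q n).eval t‖ ≤ M := fun n => by
    apply Continuous.bounded_above_of_compact_support
    · exact ψ.continuous.mul (q n).continuous
    · exact ψ.hasCompactSupport.mul_right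
  choose M hM using hM
  have hM0 : ∀ n, 0 ≤ M n := fun n => (norm_nonneg _).trans (hM n 0)
  let m : ℕ → ℝ := fun n => min c (1 / ((n:ℝ) + 1))
  have hm : ∀ n, 0 < m n := fun n => lt_min hc (by positivity)
  let δ : ℕ → ℝ := fun n => m n / (M n + 1)
  have hδ : ∀ n, 0 < δ n := fun n => div_pos (hm n) (by linarith [hM0 n])
  let F : ℕ → ℝ → ℝ := fun n y => δ n * (ψ (y - (2 * n + 2)) * (q n).eval (y - (2 * n + 2)))
  have hFb : ∀ n y, |F n y| ≤ m n := fun n y => by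
    have h1 := hM n (y - (2 * n + 2))
    rw [Real.norm_eq_abs] at h1
    simp only [F]
    rw [abs_mul, abs_of_pos (hδ n)]
    calc _ ≤ δ n * (M n + 1) := by
          apply mul_le_mul_of_nonneg_left _ (hδ n).le
          linarith
      _ = m n := div_mul_cancel₀ _ (by linarith [hM0 n])
  have hFs : ∀ n y, F n y ≠ 0 → 2 * (n:ℝ) + 7/4 < y ∧ y < 2 * n + 13/4 := fun n y h => by
    have := hψ0 (y - (2 * n + 2)) (fun h0 => h (by simp [F, h0]))
    constructor <;> linarith [this.1, this.2]
  have hFc : ∀ n, ContDiff ℝ (⊤ : ℕ∞) (F n) := fun n => by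
    have h1 : ContDiff ℝ (⊤ : ℕ∞) (fun y : ℝ => y - (2 * (n:ℝ) + 2)) := by fun_prop
    have h2 : ContDiff ℝ (⊤ : ℕ∞) (fun y : ℝ => (q n).eval y) := by simpa using (q n).contDiff_aeval (𝕜 := ℝ) (⊤ : ℕ∞)
    exact contDiff_const.mul ((ψ.contDiff.comp h1).mul (h2.comp h1))
  let P : ℝ → ℝ := fun y => ∑ᶠ n, F n y
  have hP0 : ∀ y < 7/4, P y = 0 := fun y hy => by
    have : ∀ n, F n y = 0 := fun n => by
      by_contra h
      have := (hFs n y h).1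
      have : (0:ℝ) ≤ n := n.cast_nonneg
      linarith
    simp [P, this]
  have hP1 : ∀ (k : ℕ) y, 2 * (k:ℝ) + 5/4 < y → y < 2 * k + 15/4 → P y = F k y := fun k y h1 h2 => by
    apply finsum_eq_single
    intro n hn
    by_contra h
    obtain ⟨h3, h4⟩ := hFs n y h
    rcases lt_or_gt_of_ne hn with h5 | h5
    · have : (n:ℝ) + 1 ≤ k := by exact_mod_cast h5
      linarith
    · have : (k:ℝ) + 1 ≤ n := by exact_mod_cast h5
      linarith
  have hcov : ∀ y : ℝ, 7/4 ≤ y → ∃ k : ℕ, 2 * (k:ℝ) + 5/4 < y ∧ y < 2 * k + 15/4 := fun y hy => by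
    refine ⟨⌊(y - 3/2) / 2⌋₊, ?_, ?_⟩
    · have := Nat.floor_le (a := (y - 3/2) / 2) (by linarith)
      linarith
    · have := Nat.lt_floor_add_one ((y - 3/2) / 2)
      linarith
  refine ⟨P, ?_, fun y hy => hP0 y (by linarith), ?_, ?_, ?_⟩
  · rw [contDiff_iff_contDiffAt]
    intro y
    rcases lt_or_ge y (7/4) with h | h
    · apply (contDiffAt_const (c := (0:ℝ))).congr_of_eventuallyEq
      filter_upwards [Iio_mem_nhds h] with z hz using hP0 z hz
    · obtain ⟨k, h1, h2⟩ := hcov y h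
      apply (hFc k).contDiffAt.congr_of_eventuallyEq
      filter_upwards [Ioo_mem_nhds h1 h2] with z hz using hP1 k z hz.1 hz.2
  · intro y
    rcases lt_or_ge y (7/4) with h | h
    · rw [hP0 y h, abs_zero]; exact hc.le
    · obtain ⟨k, h1, h2⟩ := hcov y h
      rw [hP1 k y h1 h2]
      exact (hFb k y).trans (min_le_left _ _)
  · rw [Metric.tendsto_atTop]
    intro ε hε
    obtain ⟨N, hN⟩ := exists_nat_one_div_lt hε
    refine ⟨2 * N + 4, fun y hy => ?_⟩
    obtain ⟨k, h1, h2⟩ := hcov y (by have : (0:ℝ) ≤ N := N.cast_nonneg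
                                     linarith)
    rw [hP1 k y h1 h2, Real.dist_eq, sub_zero]
    refine lt_of_le_of_lt ((hFb k y).trans (min_le_right _ _)) (lt_of_le_of_lt ?_ hN)
    apply one_div_le_one_div_of_le (by positivity)
    linarith
  · intro f hf ε hε
    obtain ⟨n, hn⟩ := hq f hf ε hε
    refine ⟨n, (δ n)⁻¹, fun t ht => ?_⟩
    rw [hP1 n _ (by linarith [ht.1]) (by linarith [ht.2])]
    simp only [F, add_sub_cancel_right, hψ1 t ht, one_mul]
    rw [inv_mul_cancel_left₀ (hδ n).ne']
    exact hn t ht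


/-- For any positive reals α and λ there exists a `C^∞` function
`σ : ℝ → ℝ` that tends to 0 at −∞ and to 1 at +∞, is strictly increasing on
`(−∞, α)`, is λ-strictly increasing on `[α, ∞)` (i.e. within distance λ of a
strictly increasing function there), and such that one-neuron networks
`c₀ + c₁ · σ((α/(b−a))·t − θ)` are dense in `C[a, b]` for every interval. -/
theorem universal_sigmoidal_one_neuron
    (α lam : ℝ) (hα : 0 < α) (hlam : 0 < lam) :
    ∃ σ : ℝ → ℝ,
      ContDiff ℝ (⊤ : ℕ∞) σ ∧
      Filter.Tendsto σ Filter.atBot (nhds 0) ∧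
      Filter.Tendsto σ Filter.atTop (nhds 1) ∧
      StrictMonoOn σ (Set.Iio α) ∧
      (∃ u : ℝ → ℝ, StrictMonoOn u (Set.Ici α) ∧
        ∀ x ∈ Set.Ici α, |σ x - u x| ≤ lam) ∧
      (∀ a b : ℝ, a < b → ∀ f : ℝ → ℝ, ContinuousOn f (Set.Icc a b) →
        ∀ ε : ℝ, 0 < ε →
          ∃ c₀ c₁ θ : ℝ, ∀ t ∈ Set.Icc a b,
            |f t - c₁ * σ (α / (b - a) * t - θ) - c₀| < ε) := by
  obtain ⟨P, hPc, hP0, hPb, hPt, hPd⟩ := bump_sum (lam / 2) (by linarith)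
  have hg : ∀ x, α ≤ x → expNegInvGlue (α - x) = 0 := fun x hx =>
    expNegInvGlue.zero_of_nonpos (by linarith)
  refine ⟨fun x => 1 - expNegInvGlue (α - x) + P (x / α), ?_, ?_, ?_, ?_, ?_, ?_⟩
  · have h1 : ContDiff ℝ (⊤ : ℕ∞) (fun x : ℝ => α - x) := by fun_prop
    have h2 : ContDiff ℝ (⊤ : ℕ∞) (fun x : ℝ => x / α) := by fun_prop
    exact (contDiff_const.sub (expNegInvGlue.contDiff.comp h1)).add (hPc.comp h2)
  · have h1 : Filter.Tendsto (fun x : ℝ => 1 - Real.exp (-(α - x)⁻¹)) Filter.atBot (nhds 0) := by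
      have h2 : Filter.Tendsto (fun x : ℝ => α - x) Filter.atBot Filter.atTop := by
        simpa [sub_eq_add_neg] using
          Filter.tendsto_atTop_add_const_left Filter.atBot α Filter.tendsto_neg_atBot_atTop
      have h3 := (Real.continuous_exp.tendsto _).comp ((tendsto_inv_atTop_zero.comp h2).neg)
      have h4 := h3.const_sub 1
      simpa using h4
    refine h1.congr' ?_
    filter_upwards [Filter.eventually_lt_atBot α] with x hx
    have h5 : P (x / α) = 0 := hP0 _ ((div_le_one hα).2 hx.le)
    rw [h5, expNegInvGlue, if_neg (by linarith)]
    ring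
  · have h1 : Filter.Tendsto (fun x : ℝ => 1 + P (x / α)) Filter.atTop (nhds 1) := by
      have := (hPt.comp (Filter.tendsto_id.atTop_div_const hα)).const_add 1
      simpa using this
    refine h1.congr' ?_
    filter_upwards [Filter.eventually_ge_atTop α] with x hx
    rw [hg x hx, sub_zero]
  · intro x hx y hy hxy
    simp only [Set.mem_Iio] at hx hy
    have h5 : P (x / α) = 0 := hP0 _ ((div_le_one hα).2 hx.le)
    have h6 : P (y / α) = 0 := hP0 _ ((div_le_one hα).2 hy.le)
    simp only [h5, h6, add_zero, expNegInvGlue]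
    rw [if_neg (by linarith), if_neg (by linarith)]
    have : Real.exp (-(α - y)⁻¹) < Real.exp (-(α - x)⁻¹) := by
      apply Real.exp_lt_exp.2
      apply neg_lt_neg
      exact inv_strictAnti₀ (by linarith) (by linarith)
    linarith
  · refine ⟨fun x => 1 - lam / 2 * Real.exp (-x), ?_, ?_⟩
    · intro x _ y _ hxy
      have : Real.exp (-y) < Real.exp (-x) := Real.exp_lt_exp.2 (by linarith)
      have := mul_lt_mul_of_pos_left this (half_pos hlam)
      simp only
      linarith
    · intro x hx
      have hx' : α ≤ x := hx
      simp only
      rw [hg x hx']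
      have h1 := abs_le.1 (hPb (x / α))
      have h2 : Real.exp (-x) ≤ 1 := Real.exp_le_one_iff.2 (by linarith)
      have h3 := mul_le_mul_of_nonneg_left h2 (half_pos hlam).le
      have h4 : 0 < lam / 2 * Real.exp (-x) := by positivity
      rw [abs_le]
      constructor <;> linarith [h1.1, h1.2]
  · intro a b hab f hf ε hε
    have hba : 0 < b - a := by linarith
    have hf' : ContinuousOn (fun s => f (a + (b - a) * s)) (Set.Icc 0 1) := by
      apply hf.comp (by fun_prop)
      intro s hs
      constructor <;> nlinarith [hs.1, hs.2]
    obtain ⟨n, k, hk⟩ := hPd _ hf' ε hε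
    refine ⟨-k, k, α * a / (b - a) - α * (2 * n + 2), fun t ht => ?_⟩
    have hs : (t - a) / (b - a) ∈ Set.Icc (0:ℝ) 1 :=
      ⟨div_nonneg (by linarith [ht.1]) hba.le, (div_le_one hba).2 (by linarith [ht.2])⟩
    have h1 := hk _ hs
    have e1 : a + (b - a) * ((t - a) / (b - a)) = t := by
      field_simp
      ring
    have e2 : α / (b - a) * t - (α * a / (b - a) - α * (2 * n + 2)) =
        α * ((t - a) / (b - a) + (2 * n + 2)) := by
      field_simp
      ring
    have h0 : α ≤ α * ((t - a) / (b - a) + (2 * n + 2)) := by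
      have : (0:ℝ) ≤ n := n.cast_nonneg
      nlinarith [hs.1]
    simp only [e1] at h1
    simp only [e2]
    rw [hg _ h0, mul_div_cancel_left₀ _ hα.ne']
    convert h1 using 2
    ring
end

section
/- For any positive real numbers α and λ, there exists an infinitely differentiable function σ : ℝ → ℝ, strictly increasing on (−∞, α), λ-strictly increasing on [α, +∞), with σ(t) → 0 as t → −∞ and σ(t) → 1 as t → +∞, such that for every continuous function g : [0, 1] → ℝ and every ε > 0 there exist real numbers c₀, c₁ and s with |g(t) − c₁·σ(α·t − s) − c₀| < ε for all t ∈ [0, 1]. -/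
open Set Filter Topology

lemma aux_poly : ∃ P : ℕ → Polynomial ℝ, ∀ g : ℝ → ℝ, ContinuousOn g (Icc 0 1) →
    ∀ ε : ℝ, 0 < ε → ∃ k, ∀ t ∈ Icc (0 : ℝ) 1, |g t - (P k).eval t| < ε := by
  have hd : Dense (polynomialFunctions (Icc (0 : ℝ) 1) : Set C(Icc (0 : ℝ) 1, ℝ)) := fun f =>
    continuousMap_mem_polynomialFunctions_closure 0 1 f
  obtain ⟨t, hts, htc, htd⟩ := hd.exists_countable_dense_subset
  obtain ⟨f, hf⟩ := htc.exists_eq_range htd.nonempty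
  have hP : ∀ k, ∃ p : Polynomial ℝ, ∀ x : Icc (0 : ℝ) 1, f k x = p.eval (x : ℝ) := by
    intro k
    have : f k ∈ (polynomialFunctions (Icc (0 : ℝ) 1) : Set C(Icc (0 : ℝ) 1, ℝ)) :=
      hts (hf ▸ mem_range_self k)
    rw [polynomialFunctions_coe] at this
    obtain ⟨p, hp⟩ := this
    refine ⟨p, fun x => ?_⟩
    rw [← hp]
    simp
  choose P hP using hP
  refine ⟨P, fun g hg ε hε => ?_⟩
  let G : C(Icc (0 : ℝ) 1, ℝ) := ⟨(Icc (0 : ℝ) 1).domRestrict g, hg.domRestrict⟩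
  obtain ⟨y, hy, hyd⟩ := htd.exists_dist_lt G hε
  rw [hf] at hy
  obtain ⟨k, rfl⟩ := hy
  refine ⟨k, fun t ht => ?_⟩
  have := (ContinuousMap.dist_lt_iff hε).1 hyd ⟨t, ht⟩
  rw [hP, Real.dist_eq] at this
  exact this

lemma aux_scale (p : Polynomial ℝ) (m : ℝ) (hm : 0 < m) :
    ∃ d : ℝ, 0 < d ∧ ∀ z : ℝ, |z| ≤ 3 / 2 → |d * p.eval (z + 1 / 2)| ≤ m := by
  obtain ⟨M, hM⟩ := (isCompact_Icc (a := (-(3 / 2) : ℝ)) (b := 3 / 2)).exists_bound_of_continuousOn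
    (f := fun z => p.eval (z + 1 / 2)) (by fun_prop)
  have hM0 : 0 ≤ M := (norm_nonneg _).trans (hM 0 (by constructor <;> norm_num))
  refine ⟨m / (M + 1), by positivity, fun z hz => ?_⟩
  have := hM z (abs_le.1 hz)
  rw [Real.norm_eq_abs] at this
  rw [abs_mul, abs_of_pos (by positivity : 0 < m / (M + 1)), div_mul_eq_mul_div,
    div_le_iff₀ (by positivity)]
  nlinarith

/-- locally finite sums of bumps -/
lemma aux_sum (c : ℝ) (F : ℕ → ℝ → ℝ) (hF : ∀ k, ContDiff ℝ (⊤ : ℕ∞) (F k))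
    (hs : ∀ (k : ℕ) (y : ℝ), 3 / 2 ≤ |y - 3 * k - c| → F k y = 0) :
    ∃ S : ℝ → ℝ, ContDiff ℝ (⊤ : ℕ∞) S ∧ (∀ (k : ℕ) (y : ℝ), |y - 3 * k - c| < 3 / 2 → S y = F k y) ∧
      ∀ y, (∀ k : ℕ, 3 / 2 ≤ |y - 3 * k - c|) → S y = 0 := by
  refine ⟨fun y => ∑ᶠ k, F k y, ?_, fun k y hk => ?_, fun y hy => ?_⟩
  · rw [contDiff_iff_contDiffAt]
    intro x
    obtain ⟨N, hN⟩ := exists_nat_gt (x - c + 3 / 2)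
    have h1 : ContDiff ℝ (⊤ : ℕ∞) (fun y => ∑ k ∈ Finset.range N, F k y) :=
      ContDiff.sum fun k _ => hF k
    refine h1.contDiffAt.congr_of_eventuallyEq ?_
    filter_upwards [Iio_mem_nhds (show x < N + c - 3 / 2 by linarith)] with y hy
    apply finsum_eq_sum_of_support_subset
    intro k hk
    by_contra hkN
    simp only [Finset.coe_range, mem_Iio, not_lt] at hkN hy
    have : (N : ℝ) ≤ k := by exact_mod_cast hkN
    refine hk (hs k y ?_)
    rw [le_abs]
    right
    have : (0 : ℝ) ≤ k := by positivity
    linarith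
  · refine finsum_eq_single _ k fun j hj => hs j y ?_
    by_contra! hlt
    rw [abs_lt] at hk hlt
    have h1 : (j : ℝ) < k + 1 := by linarith
    have h2 : (k : ℝ) < j + 1 := by linarith
    have h1' : j < k + 1 := by exact_mod_cast h1
    have h2' : k < j + 1 := by exact_mod_cast h2
    omega
  · show ∑ᶠ k, F k y = 0
    simp [fun k => hs k y (hy k)]

lemma aux_one (lam : ℝ) (hlam : 0 < lam) :
    ∃ σ : ℝ → ℝ,
      ContDiff ℝ (⊤ : ℕ∞) σ ∧ (∀ x < 1, σ x = Real.sigmoid x) ∧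
      (∀ x, |σ x - Real.sigmoid x| ≤ lam) ∧
      Tendsto σ atTop (𝓝 1) ∧
      (∀ g : ℝ → ℝ, ContinuousOn g (Icc 0 1) → ∀ ε : ℝ, 0 < ε →
          ∃ c₀ c₁ s : ℝ, ∀ t ∈ Icc (0 : ℝ) 1, |g t - c₁ * σ (t - s) - c₀| < ε) := by
  obtain ⟨P, hP⟩ := aux_poly
  have hd := fun k : ℕ => aux_scale (P k) (min (lam / 2) (1 / (k + 1 : ℝ))) (by positivity)
  choose d hd0 hd using hd
  obtain ⟨c, hc3, hc⟩ : ∃ c : ℝ, 3 ≤ c ∧ ∀ y, c - 3 / 2 ≤ y → 1 - Real.sigmoid y ≤ lam / 2 := by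
    have := Real.tendsto_sigmoid_atTop.eventually (lt_mem_nhds (show 1 - lam / 2 < 1 by linarith))
    obtain ⟨a, ha⟩ := eventually_atTop.1 this
    refine ⟨max 3 (a + 3 / 2), le_max_left _ _, fun y hy => ?_⟩
    have := ha y (by linarith [le_max_right 3 (a + 3 / 2)])
    linarith
  let β : ContDiffBump (0 : ℝ) := ⟨1, 3 / 2, by norm_num, by norm_num⟩
  have hsig : ContDiff ℝ (⊤ : ℕ∞) Real.sigmoid := contDiff_sigmoid.of_le le_top
  have hsp : ∀ k : ℕ, ContDiff ℝ (⊤ : ℕ∞)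
      (fun y : ℝ => (P k).eval (y - 3 * k - c + 1 / 2)) := fun k =>
    (show ContDiff ℝ (⊤ : ℕ∞) (fun x => (P k).eval x) from by simpa using (P k).contDiff_aeval (𝕜 := ℝ) (⊤ : ℕ∞)).comp (g := fun x => (P k).eval x)
      (f := fun y : ℝ => y - 3 * k - c + 1 / 2) (by fun_prop)
  have hsb : ∀ k : ℕ, ContDiff ℝ (⊤ : ℕ∞) (fun y : ℝ => β (y - 3 * k - c)) := fun k =>
    β.contDiff.comp (f := fun y : ℝ => y - 3 * k - c) (by fun_prop)
  obtain ⟨S, hS, hS1, hS0⟩ := aux_sum c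
    (fun k y => β (y - 3 * k - c) *
      (d k * (P k).eval (y - 3 * k - c + 1 / 2) + (1 - Real.sigmoid y)))
    (fun k => (hsb k).mul ((contDiff_const.mul (hsp k)).add (contDiff_const.sub hsig)))
    (fun k y hy => by
      rw [β.zero_of_le_dist, zero_mul]
      simpa [Real.dist_eq] using hy)
  have hB : ∀ k : ℕ, ∀ y, |y - 3 * k - c| < 3 / 2 →
      |S y| ≤ min (lam / 2) (1 / (k + 1 : ℝ)) + (1 - Real.sigmoid y) := by
    intro k y hy
    rw [hS1 k y hy, abs_mul, abs_of_nonneg β.nonneg]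
    have h1 := hd k _ hy.le
    have h2 := abs_add_le (d k * (P k).eval (y - 3 * k - c + 1 / 2)) (1 - Real.sigmoid y)
    rw [abs_of_nonneg (by linarith [Real.sigmoid_le_one y] : 0 ≤ 1 - Real.sigmoid y)] at h2
    have h3 := mul_le_of_le_one_left (abs_nonneg
      (d k * (P k).eval (y - 3 * k - c + 1 / 2) + (1 - Real.sigmoid y)))
      (β.le_one (x := y - 3 * k - c))
    linarith
  refine ⟨fun y => Real.sigmoid y + S y, hsig.add hS, fun x hx => ?_, fun x => ?_, ?_, ?_⟩
  · simp only [add_eq_left]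
    refine hS0 x fun k => ?_
    rw [le_abs]
    right
    have : (0 : ℝ) ≤ k := by positivity
    linarith
  · rw [add_sub_cancel_left]
    by_cases h : ∃ k : ℕ, |x - 3 * k - c| < 3 / 2
    · obtain ⟨k, hk⟩ := h
      have h1 := hB k x hk
      have h2 := hc x (by
        have := (abs_lt.1 hk).1
        have : (0 : ℝ) ≤ k := by positivity
        linarith)
      linarith [min_le_left (lam / 2) (1 / (k + 1 : ℝ))]
    · push Not at h
      rw [hS0 x h]
      simpa using hlam.le
  · have hS' : Tendsto S atTop (𝓝 0) := by
      have hg : Tendsto (fun y : ℝ => 3 / (y - c) + (1 - Real.sigmoid y)) atTop (𝓝 0) := by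
        have h1 : Tendsto (fun y : ℝ => 3 / (y - c)) atTop (𝓝 0) :=
          tendsto_const_nhds.div_atTop (tendsto_atTop_add_const_right _ (-c) tendsto_id)
        simpa using h1.add ((tendsto_const_nhds (x := (1 : ℝ))).sub Real.tendsto_sigmoid_atTop)
      refine squeeze_zero_norm' ?_ hg
      filter_upwards [eventually_gt_atTop c] with y hy
      have hy' : 0 < y - c := by linarith
      rw [Real.norm_eq_abs]
      by_cases h : ∃ k : ℕ, |y - 3 * k - c| < 3 / 2
      · obtain ⟨k, hk⟩ := h
        have h1 := hB k y hk
        have h2 : 1 / (k + 1 : ℝ) ≤ 3 / (y - c) := by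
          rw [div_le_div_iff₀ (by positivity) hy']
          linarith [(abs_lt.1 hk).2]
        linarith [min_le_right (lam / 2) (1 / (k + 1 : ℝ))]
      · push Not at h
        rw [hS0 y h, abs_zero]
        have := Real.sigmoid_le_one y
        have : 0 < 3 / (y - c) := by positivity
        linarith
    simpa using Real.tendsto_sigmoid_atTop.add hS'
  · intro g hg ε hε
    obtain ⟨k, hk⟩ := hP g hg ε hε
    refine ⟨-(1 / d k), 1 / d k, -(3 * k + c - 1 / 2), fun t ht => ?_⟩
    have e : t - -(3 * k + c - 1 / 2) - 3 * k - c = t - 1 / 2 := by ring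
    have h1 : |t - 1 / 2| ≤ 1 := by
      rw [abs_le]; constructor <;> linarith [ht.1, ht.2]
    have hb : β (t - 1 / 2) = 1 := β.one_of_mem_closedBall (by
      simpa [Real.dist_eq] using h1)
    have h2 := hS1 k (t - -(3 * k + c - 1 / 2)) (by rw [e]; linarith)
    simp only [e, hb, sub_add_cancel, one_mul] at h2
    beta_reduce
    rw [h2]
    generalize Real.sigmoid (t - -(3 * k + c - 1 / 2)) = w
    have := hd0 k
    convert hk t ht using 2
    field_simp
    ring


/-- For any positive reals α and λ there exists a `C^∞` function
`σ : ℝ → ℝ`, strictly increasing on `(−∞, α)`, λ-strictly increasing on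
`[α, ∞)`, sigmoidal (σ → 0 at −∞, σ → 1 at +∞), such that for every continuous
`g` on `[0, 1]` and every ε > 0 there are `c₀, c₁, s` with
`|g t − c₁·σ(α·t − s) − c₀| < ε` on `[0, 1]`. -/
theorem universal_sigmoidal_unit_interval
    (α lam : ℝ) (hα : 0 < α) (hlam : 0 < lam) :
    ∃ σ : ℝ → ℝ,
      ContDiff ℝ (⊤ : ℕ∞) σ ∧
      StrictMonoOn σ (Set.Iio α) ∧
      (∃ u : ℝ → ℝ, StrictMonoOn u (Set.Ici α) ∧
        ∀ x ∈ Set.Ici α, |σ x - u x| ≤ lam) ∧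
      Filter.Tendsto σ Filter.atBot (nhds 0) ∧
      Filter.Tendsto σ Filter.atTop (nhds 1) ∧
      (∀ g : ℝ → ℝ, ContinuousOn g (Set.Icc 0 1) →
        ∀ ε : ℝ, 0 < ε →
          ∃ c₀ c₁ s : ℝ, ∀ t ∈ Set.Icc (0 : ℝ) 1,
            |g t - c₁ * σ (α * t - s) - c₀| < ε) := by
  obtain ⟨τ, h1, h2, h3, h4, h5⟩ := aux_one lam hlam
  have hlt : ∀ x y : ℝ, x < y → x / α < y / α := fun x y h => by gcongr
  refine ⟨fun x => τ (x / α), h1.comp (f := fun x => x / α) (by fun_prop), ?_,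
    ⟨fun x => Real.sigmoid (x / α), ?_, fun x _ => h3 _⟩, ?_, ?_, ?_⟩
  · intro x hx y hy hxy
    show τ (x / α) < τ (y / α)
    rw [h2 _ ((div_lt_one hα).2 hx), h2 _ ((div_lt_one hα).2 hy)]
    exact Real.sigmoid_strictMono (hlt x y hxy)
  · intro x _ y _ hxy
    exact Real.sigmoid_strictMono (hlt x y hxy)
  · refine (Real.tendsto_sigmoid_atBot.comp
      (Filter.tendsto_id.atBot_div_const hα)).congr' ?_
    filter_upwards [Filter.eventually_lt_atBot α] with x hx
    exact (h2 _ ((div_lt_one hα).2 hx)).symm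
  · exact h4.comp (Filter.tendsto_id.atTop_div_const hα)
  · intro g hg ε hε
    obtain ⟨c₀, c₁, s, h⟩ := h5 g hg ε hε
    refine ⟨c₀, c₁, α * s, fun t ht => ?_⟩
    have : (α * t - α * s) / α = t - s := by field_simp
    simp only [this]
    exact h t ht
end
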